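/- (Intertwining property on ℝ) Let K be a monotone kernel function that is in addition singular and strictly concave on (−∞,0) and on (0,∞), let n ∈ ℕ, r₁,…,rₙ > 0 with R := r₁ + … + rₙ, and let J be an n-field function on ℝ that is R-admissible for K. Then there do not exist x, y ∈ S^∞ with x ≠ y, all local maxima mⱼ(x), mⱼ(y) (j = 0,…,n) finite, and mⱼ(x) ≥ mⱼ(y) for every j = 0,…,n. -/

import Mathlib

open Filter Set Topology

noncomputable section

/-- A kernel function: finite on `ℝ \ {0}`, concave on `(-∞,0)` and `(0,∞)`,
with equal one-sided limits at `0`, equal to `K 0` (real or `⊥`). -/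
def IsKernel (K : ℝ → EReal) : Prop :=
  (∀ t : ℝ, t ≠ 0 → K t ≠ ⊥ ∧ K t ≠ ⊤) ∧
  ConcaveOn ℝ (Iio (0:ℝ)) (fun t => (K t).toReal) ∧
  ConcaveOn ℝ (Ioi (0:ℝ)) (fun t => (K t).toReal) ∧
  K 0 ≠ ⊤ ∧
  Tendsto K (𝓝[<] (0:ℝ)) (𝓝 (K 0)) ∧
  Tendsto K (𝓝[>] (0:ℝ)) (𝓝 (K 0))

/-- A monotone kernel: nonincreasing on `(-∞,0)`, nondecreasing on `(0,∞)`. -/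
def MonotoneKernel (K : ℝ → EReal) : Prop :=
  IsKernel K ∧ AntitoneOn K (Iio (0:ℝ)) ∧ MonotoneOn K (Ioi (0:ℝ))

/-- An `n`-field function on `ℝ`: bounded above, finite at more than `n` points. -/
def IsFieldFn (n : ℕ) (J : ℝ → EReal) : Prop :=
  (∃ c : ℝ, ∀ t, J t ≤ (c : EReal)) ∧
  (∃ S : Finset ℝ, n < S.card ∧ ∀ x ∈ S, J x ≠ ⊥)

/-- `J` is `R`-admissible for `K`: `J(t) + R·K(t) → -∞` as `|t| → ∞`. -/
def IsAdmissible (K J : ℝ → EReal) (R : ℝ) : Prop :=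
  Tendsto (fun t => J t + (R : EReal) * K t) (cocompact ℝ) (𝓝 ⊥)

/-- The sum of translates function `F(y,t) = J(t) + ∑ rⱼ K(t - yⱼ)`. -/
def SumTrans (K J : ℝ → EReal) {n : ℕ} (r y : Fin n → ℝ) (t : ℝ) : EReal :=
  J t + ∑ j, (r j : EReal) * K (t - y j)

/-- For monotone `y`, `cell y j` is `[y_j, y_{j+1}]` (with `y_0 = -∞`, `y_{n+1} = ∞`). -/
def cell {n : ℕ} (y : Fin n → ℝ) (j : Fin (n+1)) : Set ℝ :=
  {t | (∀ i : Fin n, (i : ℕ) < (j : ℕ) → y i ≤ t) ∧ (∀ i : Fin n, (j : ℕ) ≤ (i : ℕ) → t ≤ y i)}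

/-- The local maximum `mⱼ(y)` over the `j`-th cell. -/
def mloc (K J : ℝ → EReal) {n : ℕ} (r y : Fin n → ℝ) (j : Fin (n+1)) : EReal :=
  sSup (SumTrans K J r y '' cell y j)

/-- The local maximum `mⱼ^b(y)` over the `j`-th cell intersected with `[-b,b]`. -/
def mlocSeg (K J : ℝ → EReal) {n : ℕ} (r y : Fin n → ℝ) (b : ℝ) (j : Fin (n+1)) : EReal :=
  sSup (SumTrans K J r y '' (cell y j ∩ Icc (-b) b))

/-- `q` has the Mhaskar–Rakhmanov–Saff property for `(K, J, R)` (with `n` nodes). -/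
def HasMRS (K J : ℝ → EReal) (R : ℝ) (n : ℕ) (q : ℝ) : Prop :=
  ∀ r : Fin n → ℝ, (∀ j, 0 < r j) → (∑ j, r j) ≤ R →
    ∀ y : Fin n → ℝ, Monotone y →
      sSup (range (SumTrans K J r y)) = sSup (SumTrans K J r y '' Icc (-q) q)

/-- A strictly concave function on an open convex subset of `ℝ` lies strictly below a support line
at every point. -/
theorem exists_strict_supergradient {S : Set ℝ} (hS : IsOpen S) {k : ℝ → ℝ}
    (hk : StrictConcaveOn ℝ S k) :
    ∃ σ : ℝ → ℝ, ∀ t ∈ S, ∀ u ∈ S, u ≠ t → k u < k t + σ t * (u - t) := by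
  have main : ∀ t ∈ S, ∃ s : ℝ, ∀ u ∈ S, k u ≤ k t + s * (u - t) := by
    intro t ht
    obtain ⟨ε, hε, hball⟩ := Metric.isOpen_iff.1 hS t ht
    have hr : t + ε / 2 ∈ S := hball (by
      rw [Metric.mem_ball, Real.dist_eq, add_sub_cancel_left, abs_of_pos] <;> linarith)
    have hl : t - ε / 2 ∈ S := hball (by
      rw [Metric.mem_ball, Real.dist_eq, sub_sub_cancel_left, abs_neg, abs_of_pos] <;> linarith)
    set A : Set ℝ := (fun u => (k u - k t) / (u - t)) '' (S ∩ Ioi t) with hA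
    have hbound : ∀ v ∈ S, v < t → ∀ a ∈ A, a ≤ (k t - k v) / (t - v) := by
      rintro v hv hvt _ ⟨u, ⟨huS, hut⟩, rfl⟩
      exact hk.concaveOn.slope_anti_adjacent hv huS hvt hut
    have hne : A.Nonempty := ⟨_, t + ε / 2, ⟨hr, by simp only [mem_Ioi]; linarith⟩, rfl⟩
    have hbdd : BddAbove A := ⟨_, fun a ha => hbound _ hl (by linarith) a ha⟩
    refine ⟨sSup A, fun u hu => ?_⟩
    rcases lt_trichotomy u t with h | h | h
    · have := csSup_le hne (hbound u hu h)
      rw [le_div_iff₀ (by linarith)] at this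
      linarith
    · simp [h]
    · have := le_csSup hbdd ⟨u, ⟨hu, h⟩, rfl⟩
      rw [div_le_iff₀ (by linarith)] at this
      linarith
  choose! σ hσ using main
  refine ⟨σ, fun t ht u hu hne => ?_⟩
  have h1 := hk.2 hu ht hne (by norm_num : (0 : ℝ) < 1 / 2) (by norm_num : (0 : ℝ) < 1 / 2)
    (by norm_num)
  have h2 := hσ t ht _ (hk.1 hu ht (by norm_num : (0 : ℝ) ≤ 1 / 2)
    (by norm_num : (0 : ℝ) ≤ 1 / 2) (by norm_num))
  simp only [smul_eq_mul] at h1 h2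
  linarith

/-- A matrix whose rows change sign from negative to positive at the diagonal, and whose columns
are monotone on each side of the diagonal, has a nonzero nonnegative vector annihilated by all rows
but the first. -/
theorem exists_nonneg_annihilator (G : Finset ℕ) : ∀ (s : ℕ → ℕ → ℝ), G.Nonempty →
    (∀ B ∈ G, (∃ A ∈ G, A < B) → ∀ j ∈ G, j < B → s B j < 0) →
    (∀ B ∈ G, (∃ A ∈ G, A < B) → ∀ j ∈ G, B ≤ j → 0 < s B j) →
    (∀ B ∈ G, (∃ A ∈ G, A < B) → ∀ B' ∈ G, B < B' → ∀ j ∈ G, j < B → s B j < s B' j) →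
    (∀ B ∈ G, (∃ A ∈ G, A < B) → ∀ B' ∈ G, B < B' → ∀ j ∈ G, B' ≤ j → s B j ≤ s B' j) →
    ∃ c : ℕ → ℝ, (∀ j ∈ G, 0 ≤ c j) ∧ (∃ j ∈ G, 0 < c j) ∧
      ∀ B ∈ G, (∃ A ∈ G, A < B) → ∑ j ∈ G, c j * s B j = 0 := by
  induction G using Finset.induction_on_max with
  | empty => simp
  | insert a G ha ih =>
    intro s _ hneg hpos hmonoL hmonoR
    have haG : a ∉ G := fun h => lt_irrefl _ (ha a h)
    rcases G.eq_empty_or_nonempty with rfl | hG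
    · exact ⟨fun _ => 1, by simp⟩
    have hamem : a ∈ insert a G := Finset.mem_insert_self a G
    have hmem : ∀ {j}, j ∈ G → j ∈ insert a G := fun h => Finset.mem_insert_of_mem h
    have hlift : ∀ {B}, (∃ A ∈ G, A < B) → ∃ A ∈ insert a G, A < B :=
      fun ⟨A, hA, h⟩ => ⟨A, hmem hA, h⟩
    have hexa : ∃ A ∈ insert a G, A < a := hG.imp fun A hA => ⟨hmem hA, ha A hA⟩
    have haa : 0 < s a a := hpos a hamem hexa a hamem le_rfl
    have hcoef : ∀ j ∈ G, 0 < -s a j / s a a := fun j hj =>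
      div_pos (by linarith [hneg a hamem hexa j (hmem hj) (ha j hj)]) haa
    obtain ⟨c, hc0, ⟨j₀, hj₀, hcj₀⟩, hc⟩ :=
      ih (fun B j => s B j + -s a j / s a a * s B a) hG
        (by
          intro B hB hex j hj hjB
          have h1 := hmonoL B (hmem hB) (hlift hex) a hamem (ha B hB) j (hmem hj) hjB
          have h2 := hmonoR B (hmem hB) (hlift hex) a hamem (ha B hB) a hamem le_rfl
          have h3 := hneg B (hmem hB) (hlift hex) j (hmem hj) hjB
          have h4 := hneg a hamem hexa j (hmem hj) (ha j hj)
          have h5 := hpos B (hmem hB) (hlift hex) a hamem (ha B hB).le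
          have h6 : -s a j / s a a * s B a ≤ -s a j / s a a * s a a :=
            mul_le_mul_of_nonneg_left h2 (hcoef j hj).le
          rw [div_mul_cancel₀ _ haa.ne'] at h6
          linarith)
        (by
          intro B hB hex j hj hjB
          exact add_pos (hpos B (hmem hB) (hlift hex) j (hmem hj) hjB)
            (mul_pos (hcoef j hj) (hpos B (hmem hB) (hlift hex) a hamem (ha B hB).le)))
        (by
          intro B hB hex B' hB' hBB' j hj hjB
          exact add_lt_add_of_lt_of_le (hmonoL B (hmem hB) (hlift hex) B' (hmem hB') hBB' j (hmem hj) hjB)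
            (mul_le_mul_of_nonneg_left
              (hmonoR B (hmem hB) (hlift hex) B' (hmem hB') hBB' a hamem (ha B' hB').le)
              (hcoef j hj).le))
        (by
          intro B hB hex B' hB' hBB' j hj hjB
          exact add_le_add (hmonoR B (hmem hB) (hlift hex) B' (hmem hB') hBB' j (hmem hj) hjB)
            (mul_le_mul_of_nonneg_left
              (hmonoR B (hmem hB) (hlift hex) B' (hmem hB') hBB' a hamem (ha B' hB').le)
              (hcoef j hj).le))
    have hsum : ∀ B, ∑ j ∈ insert a G,
        Function.update c a (∑ j ∈ G, c j * (-s a j / s a a)) j * s B j =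
        ∑ j ∈ G, c j * (s B j + -s a j / s a a * s B a) := by
      intro B
      rw [Finset.sum_insert haG, Function.update_self, Finset.sum_mul, ← Finset.sum_add_distrib]
      refine Finset.sum_congr rfl fun j hj => ?_
      rw [Function.update_of_ne (ha j hj).ne]
      ring
    refine ⟨Function.update c a (∑ j ∈ G, c j * (-s a j / s a a)), fun j hj => ?_,
      ⟨j₀, hmem hj₀, by rwa [Function.update_of_ne (ha j₀ hj₀).ne]⟩, fun B hB hex => ?_⟩
    · rcases Finset.mem_insert.1 hj with rfl | hj
      · rw [Function.update_self]
        exact Finset.sum_nonneg fun j hj => mul_nonneg (hc0 j hj) (hcoef j hj).le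
      · rw [Function.update_of_ne (ha j hj).ne]
        exact hc0 j hj
    · rw [hsum]
      rcases Finset.mem_insert.1 hB with rfl | hB
      · refine Finset.sum_eq_zero fun j _ => ?_
        rw [div_mul_cancel₀ _ haa.ne']
        ring
      · obtain ⟨A, hA, hAB⟩ := hex
        refine hc B hB ⟨A, ?_, hAB⟩
        exact Finset.mem_of_mem_insert_of_ne hA (hAB.trans (ha B hB)).ne

section Supergradient

variable {k σ : ℝ → ℝ}

theorem supergradient_lt (hσ : ∀ t u, 0 < t * u → u ≠ t → k u < k t + σ t * (u - t))
    {t u : ℝ} (h : 0 < t * u) (htu : t < u) : σ u < σ t := by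
  have h1 := hσ t u h htu.ne'
  have h2 := hσ u t (by rwa [mul_comm]) htu.ne
  by_contra! hle
  nlinarith [mul_nonneg (sub_nonneg.2 hle) (sub_pos.2 htu).le]

theorem supergradient_le (hσ : ∀ t u, 0 < t * u → u ≠ t → k u < k t + σ t * (u - t))
    {t u : ℝ} (h : 0 < t * u) (htu : t ≤ u) : σ u ≤ σ t := by
  rcases htu.eq_or_lt with rfl | h'
  · rfl
  · exact (supergradient_lt hσ h h').le

/-- Moving from `u` to `v` in the direction of `w` changes `k` by more than the slope at `w`
predicts. -/
theorem slope_mul_lt_sub (hσ : ∀ t u, 0 < t * u → u ≠ t → k u < k t + σ t * (u - t))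
    {u v w : ℝ} (huv : 0 < v * u) (hvw : 0 < v * w)
    (h : (u < v ∧ v ≤ w) ∨ (v < u ∧ w ≤ v)) : σ w * (v - u) < k v - k u := by
  rcases h with ⟨h1, h2⟩ | ⟨h1, h2⟩
  · have h3 := hσ v u huv h1.ne
    have h4 := supergradient_le hσ hvw h2
    nlinarith [mul_nonneg (sub_nonneg.2 h4) (sub_pos.2 h1).le]
  · have h3 := hσ v u huv h1.ne'
    have h4 := supergradient_le hσ (by rwa [mul_comm]) h2
    nlinarith [mul_nonneg (sub_nonneg.2 h4) (sub_pos.2 h1).le]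

theorem lt_of_pos_lt (hσ : ∀ t u, 0 < t * u → u ≠ t → k u < k t + σ t * (u - t))
    (hpos : ∀ t, 0 < t → 0 < σ t) {t u : ℝ} (ht : 0 < t) (htu : t < u) : k t < k u := by
  have h1 := hσ u t (mul_pos (ht.trans htu) ht) htu.ne
  nlinarith [mul_pos (hpos u (ht.trans htu)) (sub_pos.2 htu)]

theorem lt_of_lt_neg (hσ : ∀ t u, 0 < t * u → u ≠ t → k u < k t + σ t * (u - t))
    (hneg : ∀ t, t < 0 → σ t < 0) {t u : ℝ} (hu : u < 0) (htu : t < u) : k u < k t := by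
  have h1 := hσ t u (mul_pos_of_neg_of_neg (htu.trans hu) hu) htu.ne'
  nlinarith [mul_pos (neg_pos.2 (hneg t (htu.trans hu))) (sub_pos.2 htu)]

end Supergradient

theorem exists_sign_change {v : ℕ → ℝ} {a b : ℕ} (hab : a < b) (ha : v a ≤ 0) (hb : 0 ≤ v b) :
    ∃ j, a ≤ j ∧ j < b ∧ v j ≤ 0 ∧ 0 ≤ v (j + 1) := by
  induction b, hab using Nat.le_induction with
  | base => exact ⟨a, le_rfl, Nat.lt_succ_self a, ha, hb⟩
  | succ b hab ih =>
    rcases le_total (v b) 0 with h | h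
    · exact ⟨b, (Nat.lt_of_succ_le hab).le, Nat.lt_succ_self b, h, hb⟩
    · obtain ⟨j, h1, h2, h3⟩ := ih h
      exact ⟨j, h1, h2.trans (Nat.lt_succ_self b), h3⟩

/-- Between two consecutive cells of `x` contained in the corresponding cells of `y`, there is a
pivot towards which all nodes move. -/
theorem exists_pivot {n : ℕ} {x y : ℕ → ℝ} (hy : MonotoneOn y (Icc 1 n)) {G : Finset ℕ}
    (hG : ∀ j, j ∈ G ↔ j ≤ n ∧ y j ≤ x j ∧ x (j + 1) ≤ y (j + 1))
    {z : ℕ → ℝ}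
    (hzy : ∀ j ∈ G, ∀ i ∈ Icc 1 n, (i ≤ j → y i < z j) ∧ (j < i → z j < y i))
    {B : ℕ} (hB : B ∈ G) (hex : ∃ A ∈ G, A < B) :
    ∃ β : ℝ, (∀ j ∈ G, j < B → z j < β) ∧ (∀ j ∈ G, B ≤ j → β < z j) ∧
      ∀ i, i ≤ B → (∀ j ∈ G, j < B → j < i) →
        (x i < y i → y i ≤ β) ∧ (y i < x i → β ≤ y i) := by
  classical
  obtain ⟨A, ⟨hA, hAB⟩, hmax⟩ : ∃ A, (A ∈ G ∧ A < B) ∧ ∀ j, j ∈ G → j < B → j ≤ A := by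
    obtain ⟨A, hA, hmax⟩ := Finset.exists_max_image (G.filter fun j => j < B) id
      (hex.imp fun A h => Finset.mem_filter.2 h)
    exact ⟨A, Finset.mem_filter.1 hA, fun j hj hjB => hmax j (Finset.mem_filter.2 ⟨hj, hjB⟩)⟩
  have hBn := ((hG B).1 hB).1
  obtain ⟨m, ⟨hAm, hmB, hm⟩, hmmax⟩ : ∃ m, (A < m ∧ m ≤ B ∧ (m = A + 1 ∨ x m < y m)) ∧
      ∀ i, A < i → i ≤ B → x i < y i → i ≤ m := by
    obtain ⟨m, hm, hmax⟩ := Finset.exists_max_image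
      ((Finset.Icc (A + 1) B).filter fun i => i = A + 1 ∨ x i < y i) id
      ⟨A + 1, by simp only [Finset.mem_filter, Finset.mem_Icc, true_or, and_true]; omega⟩
    simp only [Finset.mem_filter, Finset.mem_Icc] at hm hmax
    exact ⟨m, ⟨hm.1.1, hm.1.2, hm.2⟩, fun i h1 h2 h3 => hmax i ⟨⟨h1, h2⟩, Or.inr h3⟩⟩
  have hmn : m ∈ Icc 1 n := ⟨by omega, by omega⟩
  refine ⟨y m, fun j hj hjB => (hzy j hj m hmn).2 (by have := hmax j hj hjB; omega),
    fun j hj hjB => (hzy j hj m hmn).1 (by omega), fun i hiB hi => ?_⟩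
  have hAi := hi A hA hAB
  have hin : i ∈ Icc 1 n := ⟨by omega, by omega⟩
  refine ⟨fun h => hy hin hmn (hmmax i hAi hiB h), fun h => hy hmn hin ?_⟩
  by_contra! him
  have hm' : x m < y m := hm.resolve_left (by omega)
  obtain ⟨j, h1, h2, h3, h4⟩ := exists_sign_change (v := fun i => y i - x i) him
    (by linarith) (by linarith)
  have := hmax j ((hG j).2 ⟨by omega, by linarith, by linarith⟩) (by omega)
  omega

/-- If the node system `x` is moved to a different node system `y`, then on some cell of `x`
contained in the corresponding cell of `y` the sum of translates of `k` increases. -/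
theorem exists_cell_sum_pos {k σ : ℝ → ℝ}
    (hσ : ∀ t u, 0 < t * u → u ≠ t → k u < k t + σ t * (u - t))
    (hpos : ∀ t, 0 < t → 0 < σ t) (hneg : ∀ t, t < 0 → σ t < 0)
    {n : ℕ} {r : Fin n → ℝ} (hr : ∀ i, 0 < r i) {x y : ℕ → ℝ}
    (hy : MonotoneOn y (Icc 1 n)) (h0 : x 0 = y 0) (hn : x (n + 1) = y (n + 1))
    (hne : ∃ i : Fin n, x (i + 1) ≠ y (i + 1)) :
    ∃ j ≤ n, y j ≤ x j ∧ x (j + 1) ≤ y (j + 1) ∧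
      ∀ t, (∀ i ∈ Icc 1 n, (i ≤ j → x i < t) ∧ (j < i → t < x i)) →
        0 < ∑ i : Fin n, r i * (k (t - y (i + 1)) - k (t - x (i + 1))) := by
  classical
  by_contra! hcon
  set G : Finset ℕ := (Finset.range (n + 1)).filter
    (fun j => y j ≤ x j ∧ x (j + 1) ≤ y (j + 1)) with hGdef
  have hG : ∀ j, j ∈ G ↔ j ≤ n ∧ y j ≤ x j ∧ x (j + 1) ≤ y (j + 1) := by
    intro j
    rw [hGdef, Finset.mem_filter, Finset.mem_range, Nat.lt_succ_iff]
  have hsign : ∀ a b, a < b → b ≤ n + 1 → y a ≤ x a → x b ≤ y b → ∃ j ∈ G, a ≤ j ∧ j < b := by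
    intro a b hab hb h1 h2
    obtain ⟨j, h3, h4, h5, h6⟩ := exists_sign_change (v := fun i => y i - x i) hab
      (by linarith) (by linarith)
    exact ⟨j, (hG j).2 ⟨by omega, by linarith, by linarith⟩, h3, h4⟩
  have hGne : G.Nonempty := by
    obtain ⟨j, hj, -⟩ := hsign 0 (n + 1) (Nat.succ_pos n) le_rfl h0.ge hn.le
    exact ⟨j, hj⟩
  have hz : ∀ j ∈ G, ∃ t, (∀ i ∈ Icc 1 n, (i ≤ j → x i < t) ∧ (j < i → t < x i)) ∧
      ∑ i : Fin n, r i * (k (t - y (i + 1)) - k (t - x (i + 1))) ≤ 0 := fun j hj =>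
    hcon j ((hG j).1 hj).1 ((hG j).1 hj).2.1 ((hG j).1 hj).2.2
  choose! z hzx hzsum using hz
  have hzy : ∀ j ∈ G, ∀ i ∈ Icc 1 n, (i ≤ j → y i < z j) ∧ (j < i → z j < y i) := by
    intro j hj i hi
    obtain ⟨hjn, h1, h2⟩ := (hG j).1 hj
    refine ⟨fun hij => ?_, fun hij => ?_⟩
    · have hj1 : j ∈ Icc 1 n := ⟨hi.1.trans hij, hjn⟩
      exact ((hy hi hj1 hij).trans h1).trans_lt ((hzx j hj j hj1).1 le_rfl)
    · have hj1 : j + 1 ∈ Icc 1 n := ⟨by omega, (Nat.succ_le_of_lt hij).trans hi.2⟩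
      exact ((hzx j hj _ hj1).2 (Nat.lt_succ_self j)).trans_le (h2.trans (hy hj1 hi hij))
  have hpiv : ∀ B ∈ G, (∃ A ∈ G, A < B) → _ := fun B hB hex => exists_pivot hy hG hzy hB hex
  choose! β hβl hβr hβ using hpiv
  have hββ : ∀ B ∈ G, (∃ A ∈ G, A < B) → ∀ B' ∈ G, B < B' → β B < β B' := by
    intro B hB hex B' hB' hBB'
    exact (hβr B hB hex B hB le_rfl).trans (hβl B' hB' ⟨B, hB, hBB'⟩ B hB hBB')
  obtain ⟨c, hc0, ⟨j₀, hj₀, hcj₀⟩, hc⟩ := exists_nonneg_annihilator G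
    (fun B j => σ (z j - β B)) hGne
    (fun B hB hex j hj hjB => hneg _ (by linarith [hβl B hB hex j hj hjB]))
    (fun B hB hex j hj hjB => hpos _ (by linarith [hβr B hB hex j hj hjB]))
    (fun B hB hex B' hB' hBB' j hj hjB => by
      have h1 := hβl B hB hex j hj hjB
      have h2 := hββ B hB hex B' hB' hBB'
      exact supergradient_lt hσ (mul_pos_of_neg_of_neg (by linarith) (by linarith))
        (by linarith))
    (fun B hB hex B' hB' hBB' j hj hjB => by
      have h1 := hβr B' hB' ⟨B, hB, hBB'⟩ j hj hjB
      have h2 := hββ B hB hex B' hB' hBB'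
      exact supergradient_le hσ (mul_pos (by linarith) (by linarith)) (by linarith))
  have hsum_lt : ∀ f g : ℕ → ℝ, (∀ j ∈ G, f j < g j) →
      ∑ j ∈ G, c j * f j < ∑ j ∈ G, c j * g j := fun f g hfg =>
    Finset.sum_lt_sum (fun j hj => mul_le_mul_of_nonneg_left (hfg j hj).le (hc0 j hj))
      ⟨j₀, hj₀, mul_lt_mul_of_pos_left (hfg j₀ hj₀) hcj₀⟩
  have hnode : ∀ i ∈ Icc 1 n, x i ≠ y i →
      0 < ∑ j ∈ G, c j * (k (z j - y i) - k (z j - x i)) := by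
    intro i hi hxy
    by_cases hright : ∃ B ∈ G, i ≤ B
    swap
    · push Not at hright
      have hxy' : x i < y i := by
        by_contra! h
        obtain ⟨j, hj, h1, h2⟩ := hsign i (n + 1) (by have := hi.2; omega) le_rfl h hn.le
        exact absurd (hright j hj) h1.not_gt
      have := hsum_lt (fun _ => 0) (fun j => k (z j - y i) - k (z j - x i)) (fun j hj => by
        have h1 := (hzx j hj i hi).2 (hright j hj)
        exact sub_pos.2 (lt_of_lt_neg hσ hneg (by linarith) (by linarith)))
      simpa using this
    by_cases hleft : ∃ A ∈ G, A < i
    swap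
    · push Not at hleft
      have hxy' : y i < x i := by
        by_contra! h
        obtain ⟨j, hj, h1, h2⟩ := hsign 0 i hi.1 (by have := hi.2; omega) h0.ge h
        exact absurd (hleft j hj) h2.not_ge
      have := hsum_lt (fun _ => 0) (fun j => k (z j - y i) - k (z j - x i)) (fun j hj => by
        have h1 := (hzx j hj i hi).1 (hleft j hj)
        exact sub_pos.2 (lt_of_pos_lt hσ hpos (by linarith) (by linarith)))
      simpa using this
    obtain ⟨B, ⟨hB, hiB⟩, hmin⟩ : ∃ B, (B ∈ G ∧ i ≤ B) ∧ ∀ j ∈ G, j < B → j < i := by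
      refine ⟨Nat.find hright, Nat.find_spec hright, fun j hj hjB => ?_⟩
      by_contra! h
      exact Nat.find_min hright hjB ⟨hj, h⟩
    have hex : ∃ A ∈ G, A < B := hleft.imp fun A h => ⟨h.1, h.2.trans_le hiB⟩
    have hβi := hβ B hB hex i hiB hmin
    have := hsum_lt (fun j => σ (z j - β B) * (x i - y i))
      (fun j => k (z j - y i) - k (z j - x i)) (fun j hj => by
        have hcase : (z j - x i < z j - y i ∧ z j - y i ≤ z j - β B) ∨
            (z j - y i < z j - x i ∧ z j - β B ≤ z j - y i) := by
          rcases hxy.lt_or_gt with h | h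
          · exact Or.inr ⟨by linarith, by linarith [hβi.1 h]⟩
          · exact Or.inl ⟨by linarith, by linarith [hβi.2 h]⟩
        have hpp : 0 < (z j - y i) * (z j - x i) ∧ 0 < (z j - y i) * (z j - β B) := by
          rcases lt_or_ge j B with h | h
          · have h1 := (hzx j hj i hi).2 (hmin j hj h)
            have h2 := (hzy j hj i hi).2 (hmin j hj h)
            have h3 := hβl B hB hex j hj h
            constructor <;> exact mul_pos_of_neg_of_neg (by linarith) (by linarith)
          · have h1 := (hzx j hj i hi).1 (hiB.trans h)
            have h2 := (hzy j hj i hi).1 (hiB.trans h)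
            have h3 := hβr B hB hex j hj h
            constructor <;> exact mul_pos (by linarith) (by linarith)
        have := slope_mul_lt_sub hσ hpp.1 hpp.2 hcase
        rwa [sub_sub_sub_cancel_left] at this)
    simp only [← mul_assoc, ← Finset.sum_mul] at this
    rw [hc B hB hex, zero_mul] at this
    simpa only [mul_assoc] using this
  have htotal : 0 < ∑ i : Fin n, r i *
      ∑ j ∈ G, c j * (k (z j - y (i + 1)) - k (z j - x (i + 1))) := by
    have hmem : ∀ i : Fin n, (i : ℕ) + 1 ∈ Icc 1 n := fun i => ⟨by omega, i.2⟩
    obtain ⟨i₀, hi₀⟩ := hne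
    refine Finset.sum_pos' (fun i _ => ?_)
      ⟨i₀, Finset.mem_univ _, mul_pos (hr i₀) (hnode _ (hmem i₀) hi₀)⟩
    by_cases h : x (i + 1) = y (i + 1)
    · simp [h]
    · exact (mul_pos (hr i) (hnode _ (hmem i) h)).le
  have hswap : ∑ i : Fin n, r i * ∑ j ∈ G, c j * (k (z j - y (i + 1)) - k (z j - x (i + 1))) =
      ∑ j ∈ G, c j * ∑ i : Fin n, r i * (k (z j - y (i + 1)) - k (z j - x (i + 1))) := by
    simp only [Finset.mul_sum]
    rw [Finset.sum_comm]
    exact Finset.sum_congr rfl fun j _ => Finset.sum_congr rfl fun i _ => by ring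
  rw [hswap] at htotal
  exact absurd htotal (Finset.sum_nonpos fun j hj =>
    mul_nonpos_of_nonneg_of_nonpos (hc0 j hj) (hzsum j hj)).not_gt

/-- A real function which is strictly concave on both half-lines, decreasing on the left one and
increasing on the right one, has strict supergradients of the expected sign. -/
theorem exists_signed_supergradient {k : ℝ → ℝ} (hL : StrictConcaveOn ℝ (Iio 0) k)
    (hR : StrictConcaveOn ℝ (Ioi 0) k) (hanti : AntitoneOn k (Iio 0))
    (hmono : MonotoneOn k (Ioi 0)) :
    ∃ σ : ℝ → ℝ, (∀ t u, 0 < t * u → u ≠ t → k u < k t + σ t * (u - t)) ∧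
      (∀ t, 0 < t → 0 < σ t) ∧ ∀ t, t < 0 → σ t < 0 := by
  obtain ⟨σL, hσL⟩ := exists_strict_supergradient isOpen_Iio hL
  obtain ⟨σR, hσR⟩ := exists_strict_supergradient isOpen_Ioi hR
  refine ⟨fun t => if 0 < t then σR t else σL t, fun t u htu hne => ?_, fun t ht => ?_,
    fun t ht => ?_⟩
  · rcases pos_and_pos_or_neg_and_neg_of_mul_pos htu with ⟨ht, hu⟩ | ⟨ht, hu⟩
    · simp only [if_pos ht]
      exact hσR t ht u hu hne
    · simp only [if_neg ht.not_gt]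
      exact hσL t ht u hu hne
  · simp only [if_pos ht]
    have ht' : t + 1 ∈ Ioi (0 : ℝ) := by simp only [mem_Ioi]; linarith
    have h1 := hσR t ht (t + 1) ht' (by linarith)
    have h2 := hmono ht ht' (by linarith)
    linarith
  · simp only [if_neg ht.not_gt]
    have ht' : t - 1 ∈ Iio (0 : ℝ) := by simp only [mem_Iio]; linarith
    have h1 := hσL t ht (t - 1) ht' (by linarith)
    have h2 := hanti ht' ht (by linarith)
    linarith

section SumTrans

variable {K J : ℝ → EReal} {n : ℕ} {r x : Fin n → ℝ}

theorem IsKernel.coe_toReal (hK : IsKernel K) {t : ℝ} (ht : t ≠ 0) :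
    ((K t).toReal : EReal) = K t :=
  EReal.coe_toReal (hK.1 t ht).2 (hK.1 t ht).1

theorem sumTrans_eq_coe (hK : IsKernel K) {t : ℝ} (ht : ∀ i, t ≠ x i) :
    SumTrans K J r x t = J t + ((∑ i, r i * (K (t - x i)).toReal : ℝ) : EReal) := by
  have hsum : ((∑ i, r i * (K (t - x i)).toReal : ℝ) : EReal) =
      ∑ i, ((r i * (K (t - x i)).toReal : ℝ) : EReal) :=
    map_sum (⟨⟨(↑), EReal.coe_zero⟩, EReal.coe_add⟩ : ℝ →+ EReal) _ _
  rw [SumTrans, hsum]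
  congr 1
  refine Finset.sum_congr rfl fun i _ => ?_
  rw [EReal.coe_mul, hK.coe_toReal (sub_ne_zero.2 (ht i))]

theorem sumTrans_eq_bot (hsing : K 0 = ⊥) (hr : ∀ i, 0 < r i) {i : Fin n} :
    SumTrans K J r x (x i) = ⊥ := by
  rw [SumTrans, ← Finset.add_sum_erase _ _ (Finset.mem_univ i), sub_self, hsing,
    EReal.coe_mul_bot_of_pos (hr i), EReal.bot_add, EReal.add_bot]

theorem MonotoneKernel.toReal_le (hK : MonotoneKernel K) {u L : ℝ} (hu : u ≠ 0) (huL : |u| ≤ L) :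
    (K u).toReal ≤ max (K L).toReal (K (-L)).toReal := by
  obtain ⟨h1, h2⟩ := abs_le.1 huL
  rcases hu.lt_or_gt with h | h
  · have hL : -L < 0 := by linarith
    exact le_max_of_le_right (EReal.toReal_le_toReal (hK.2.1 hL h h1)
      (hK.1.1 u hu).1 (hK.1.1 _ hL.ne).2)
  · have hL : 0 < L := by linarith
    exact le_max_of_le_left (EReal.toReal_le_toReal (hK.2.2 h hL h2)
      (hK.1.1 u hu).1 (hK.1.1 _ hL.ne').2)

theorem eventually_sumTrans_lt_nhds (hK : MonotoneKernel K) (hsing : K 0 = ⊥) (hr : ∀ i, 0 < r i)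
    {c : ℝ} (hc : ∀ t, J t ≤ c) (i : Fin n) (L : ℝ) :
    ∀ᶠ t in 𝓝 (x i), SumTrans K J r x t < L := by
  set B : ℝ := ∑ i' ∈ Finset.univ.erase i, r i' *
    max (K (|x i - x i'| + 1)).toReal (K (-(|x i - x i'| + 1))).toReal with hB
  have hK0 : Tendsto K (𝓝[≠] 0) (𝓝 ⊥) := by
    rw [← Iio_union_Ioi, nhdsWithin_union, ← hsing]
    exact hK.1.2.2.2.2.1.sup hK.1.2.2.2.2.2
  have hev := hK0.eventually_lt_const (EReal.bot_lt_coe ((L - c - B) / r i))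
  rw [eventually_nhdsWithin_iff] at hev
  have htend : Tendsto (fun t => t - x i) (𝓝 (x i)) (𝓝 0) := by
    simpa using (continuous_id.sub continuous_const).tendsto (x i) (f := fun t => t - x i)
  filter_upwards [htend.eventually hev, Metric.ball_mem_nhds (x i) one_pos] with t ht hball
  by_cases hnode : ∃ i', t = x i'
  · obtain ⟨i', rfl⟩ := hnode
    rw [sumTrans_eq_bot hsing hr]
    exact EReal.bot_lt_coe L
  push Not at hnode
  have hki : r i * (K (t - x i)).toReal < L - c - B := by
    have h := ht (sub_ne_zero.2 (hnode i))
    rw [← hK.1.coe_toReal (sub_ne_zero.2 (hnode i)), EReal.coe_lt_coe_iff] at h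
    rwa [lt_div_iff₀' (hr i)] at h
  have hother : ∑ i' ∈ Finset.univ.erase i, r i' * (K (t - x i')).toReal ≤ B := by
    refine Finset.sum_le_sum fun i' _ => mul_le_mul_of_nonneg_left ?_ (hr i').le
    refine hK.toReal_le (sub_ne_zero.2 (hnode i')) ?_
    rw [Metric.mem_ball, Real.dist_eq] at hball
    linarith [abs_sub_le t (x i) (x i')]
  rw [sumTrans_eq_coe hK.1 hnode]
  refine (add_le_add_left (hc t) _).trans_lt ?_
  rw [← EReal.coe_add, EReal.coe_lt_coe_iff, ← Finset.add_sum_erase _ _ (Finset.mem_univ i)]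
  linarith

theorem eventually_sumTrans_lt_cocompact (hK : IsKernel K) (hr : ∀ i, 0 < r i) {σ : ℝ → ℝ}
    (hσ : ∀ t u, 0 < t * u → u ≠ t →
      (K u).toReal < (K t).toReal + σ t * (u - t))
    (hpos : ∀ t, 0 < t → 0 < σ t) (hneg : ∀ t, t < 0 → σ t < 0)
    (hadm : IsAdmissible K J (∑ i, r i)) (L : ℝ) :
    ∀ᶠ t in cocompact ℝ, SumTrans K J r x t < L := by
  set a : ℝ := 1 + ∑ i, |x i| with ha
  have hxa : ∀ i, 1 + |x i| ≤ a := fun i =>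
    add_le_add_right (Finset.single_le_sum (f := fun i => |x i|) (fun i _ => abs_nonneg _)
      (Finset.mem_univ i)) 1
  have ha0 : 1 ≤ a := le_add_of_nonneg_right (Finset.sum_nonneg fun i _ => abs_nonneg _)
  set s : ℝ := σ 1 - σ (-1) with hs
  have hs0 : ∀ t, 1 ≤ |t| → |σ t| ≤ s := by
    intro t ht
    have h1 := hpos 1 one_pos
    have h2 := hneg (-1) (by norm_num)
    rcases le_abs.1 ht with h | h
    · have := supergradient_le hσ (t := 1) (u := t) (by linarith) h
      rw [abs_of_pos (hpos t (by linarith))]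
      linarith
    · have := supergradient_le hσ (t := t) (u := -1) (by linarith) (by linarith)
      rw [abs_of_neg (hneg t (by linarith))]
      linarith
  set C : ℝ := ∑ i, r i * (s * |x i|) with hC
  have hlarge : ∀ᶠ t in cocompact ℝ, a < |t| := by
    have := (tendsto_norm_cocompact_atTop (E := ℝ)).eventually_gt_atTop a
    simpa only [Real.norm_eq_abs] using this
  filter_upwards [hlarge, hadm.eventually_lt_const (EReal.bot_lt_coe (L - C))] with t hta htadm
  have hterm : ∀ i, 0 < t * (t - x i) := by
    intro i
    have h1 := hxa i
    have h2 := abs_lt.1 (show |x i| < |t| by linarith)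
    rcases lt_abs.1 (show 0 < |t| by linarith) with h | h
    · rw [abs_of_pos h] at h2
      exact mul_pos h (by linarith)
    · rw [abs_of_neg (by linarith)] at h2
      exact mul_pos_of_neg_of_neg (by linarith) (by linarith)
  have hnode : ∀ i, t ≠ x i := fun i h => by
    have := hterm i
    rw [← h] at this
    simp at this
  have ht0 : t ≠ 0 := by
    rintro rfl
    rw [abs_zero] at hta
    linarith
  have hbound : ∀ i, (K (t - x i)).toReal ≤ (K t).toReal + s * |x i| := by
    intro i
    have h1 : σ t * (t - x i - t) ≤ s * |x i| := by
      refine (le_abs_self _).trans ?_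
      rw [sub_sub_cancel_left, abs_mul, abs_neg]
      exact mul_le_mul_of_nonneg_right (hs0 t (by linarith)) (abs_nonneg _)
    by_cases hne : t - x i = t
    · rw [hne] at h1 ⊢
      simpa using h1
    · linarith [hσ t _ (hterm i) hne]
  have hsum : ∑ i, r i * (K (t - x i)).toReal ≤ (∑ i, r i) * (K t).toReal + C := by
    rw [Finset.sum_mul, hC, ← Finset.sum_add_distrib]
    refine Finset.sum_le_sum fun i _ => ?_
    rw [← mul_add]
    exact mul_le_mul_of_nonneg_left (hbound i) (hr i).le
  rw [← hK.coe_toReal ht0, ← EReal.coe_mul] at htadm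
  rw [sumTrans_eq_coe hK hnode]
  refine (add_le_add_right (EReal.coe_le_coe_iff.2 hsum) (J t)).trans_lt ?_
  generalize J t = e at htadm ⊢
  induction e with
  | bot => simp
  | coe b => norm_cast at htadm ⊢; linarith
  | top => exact absurd htadm (by rw [EReal.top_add_coe]; exact not_top_lt)

theorem IsKernel.continuousAt_toReal (hK : IsKernel K) {t : ℝ} (ht : t ≠ 0) :
    ContinuousAt (fun t => (K t).toReal) t := by
  rcases ht.lt_or_gt with h | h
  · exact (hK.2.1.continuousOn isOpen_Iio).continuousAt (Iio_mem_nhds h)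
  · exact (hK.2.2.1.continuousOn isOpen_Ioi).continuousAt (Ioi_mem_nhds h)

theorem isClosed_cell (j : Fin (n + 1)) : IsClosed (cell x j) := by
  simp only [cell, ofPred_and, ofPred_forall]
  exact (isClosed_iInter fun i => isClosed_iInter fun _ => isClosed_Ici).inter
    (isClosed_iInter fun i => isClosed_iInter fun _ => isClosed_Iic)

/-- If the real part of the sum of translates increases on the interior of the `j`-th cell of `x`,
then so does the `j`-th local maximum. -/
theorem mloc_lt_mloc (hK : MonotoneKernel K) (hsing : K 0 = ⊥) (hr : ∀ i, 0 < r i)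
    {c : ℝ} (hc : ∀ t, J t ≤ c)
    (htail : ∀ L : ℝ, ∀ᶠ t in cocompact ℝ, SumTrans K J r x t < L) {y : Fin n → ℝ}
    {j : Fin (n + 1)} (hbot : mloc K J r x j ≠ ⊥) (htop : mloc K J r x j ≠ ⊤)
    (hlt : ∀ t, (∀ i : Fin n, ((i : ℕ) < j → x i < t) ∧ ((j : ℕ) ≤ i → t < x i)) →
      (∀ i : Fin n, ((i : ℕ) < j → y i < t) ∧ ((j : ℕ) ≤ i → t < y i)) ∧
      0 < ∑ i, r i * ((K (t - y i)).toReal - (K (t - x i)).toReal)) :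
    mloc K J r x j < mloc K J r y j := by
  obtain ⟨M, hM⟩ : ∃ M : ℝ, mloc K J r x j = M := ⟨_, (EReal.coe_toReal htop hbot).symm⟩
  have happrox : ∀ L : ℝ, L < M → ∃ t ∈ cell x j, (L : EReal) < SumTrans K J r x t := by
    intro L hL
    have h : (L : EReal) < mloc K J r x j := by rw [hM]; exact_mod_cast hL
    obtain ⟨_, ⟨t, ht, rfl⟩, hLt⟩ := lt_sSup_iff.1 h
    exact ⟨t, ht, hLt⟩
  set T : Set ℝ := {t ∈ cell x j | ((M - 1 : ℝ) : EReal) < SumTrans K J r x t} with hT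
  have hcompact : IsCompact (closure T) := by
    obtain ⟨S, hS, hST⟩ := mem_cocompact.1 (htail (M - 1))
    refine hS.closure_of_subset fun t ht => ?_
    by_contra h
    exact lt_asymm ht.2 (hST h)
  have hclosure : ∀ t ∈ closure T,
      ∀ i : Fin n, ((i : ℕ) < j → x i < t) ∧ ((j : ℕ) ≤ i → t < x i) := by
    intro t ht i
    have hcell : t ∈ cell x j :=
      closure_minimal (fun t ht => ht.1) (isClosed_cell j) ht
    have hne : t ≠ x i := by
      rintro rfl
      obtain ⟨u, hu1, hu2⟩ := mem_closure_iff_frequently.1 ht |>.and_eventually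
        (eventually_sumTrans_lt_nhds hK hsing hr hc i (M - 1)) |>.exists
      exact lt_asymm hu1.2 hu2
    exact ⟨fun h => lt_of_le_of_ne (hcell.1 i h) hne.symm, fun h => lt_of_le_of_ne (hcell.2 i h) hne⟩
  have hne_of : ∀ (w : Fin n → ℝ) (t : ℝ),
      (∀ i : Fin n, ((i : ℕ) < j → w i < t) ∧ ((j : ℕ) ≤ i → t < w i)) → ∀ i, t ≠ w i := by
    intro w t h i
    rcases lt_or_ge (i : ℕ) j with h' | h'
    · exact ((h i).1 h').ne'
    · exact ((h i).2 h').ne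
  have hcont : ContinuousOn
      (fun t => ∑ i, r i * ((K (t - y i)).toReal - (K (t - x i)).toReal)) (closure T) := by
    intro t ht
    have key : ∀ (w : Fin n → ℝ) (i : Fin n), t ≠ w i →
        ContinuousAt (fun t => (K (t - w i)).toReal) t := fun w i hw =>
      ContinuousAt.comp (f := fun t => t - w i) (hK.1.continuousAt_toReal (sub_ne_zero.2 hw))
        (continuous_id.sub continuous_const).continuousAt
    refine ContinuousAt.continuousWithinAt (tendsto_finsetSum _ fun i _ => ?_)
    exact ((key y i (hne_of y t (hlt t (hclosure t ht)).1 i)).sub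
      (key x i (hne_of x t (hclosure t ht) i))).const_mul (r i)
  obtain ⟨t₀, ht₀, hmin⟩ : ∃ t₀ ∈ closure T, IsMinOn _ (closure T) t₀ := by
    refine hcompact.exists_isMinOn ?_ hcont
    obtain ⟨t, ht⟩ := happrox (M - 1) (by linarith)
    exact ⟨t, subset_closure ht⟩
  set δ : ℝ := ∑ i, r i * ((K (t₀ - y i)).toReal - (K (t₀ - x i)).toReal) with hδ
  have hδ0 : 0 < δ := (hlt t₀ (hclosure t₀ ht₀)).2
  obtain ⟨t, htcell, htM⟩ := happrox (max (M - 1) (M - δ)) (max_lt (by linarith) (by linarith))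
  have htT : t ∈ closure T := subset_closure
    ⟨htcell, lt_of_le_of_lt (EReal.coe_le_coe_iff.2 (le_max_left _ _)) htM⟩
  obtain ⟨hyt, -⟩ := hlt t (hclosure t htT)
  have hδt : δ ≤ ∑ i, r i * ((K (t - y i)).toReal - (K (t - x i)).toReal) := hmin htT
  have hmem : SumTrans K J r y t ≤ mloc K J r y j :=
    le_sSup ⟨t, ⟨fun i h => ((hyt i).1 h).le, fun i h => ((hyt i).2 h).le⟩, rfl⟩
  refine lt_of_lt_of_le ?_ hmem
  have htM' : ((M - δ : ℝ) : EReal) < SumTrans K J r x t :=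
    lt_of_le_of_lt (EReal.coe_le_coe_iff.2 (le_max_right _ _)) htM
  rw [hM, sumTrans_eq_coe hK.1 (hne_of y t hyt)]
  rw [sumTrans_eq_coe hK.1 (hne_of x t (hclosure t htT))] at htM'
  simp only [mul_sub, Finset.sum_sub_distrib] at hδt
  have hJt := hc t
  generalize J t = e at htM' hJt ⊢
  induction e with
  | bot => simp at htM'
  | coe b => norm_cast at htM' ⊢; linarith
  | top => simp at hJt

end SumTrans

/-- Intertwining property on `ℝ`: if `K` is singular and strictly
concave on `(-∞,0)` and `(0,∞)`, then there are no distinct `x, y ∈ S^∞` with all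
local maxima finite such that `mⱼ(x) ≥ mⱼ(y)` for every `j = 0, …, n`. -/
theorem intertwining (K J : ℝ → EReal) (hK : MonotoneKernel K)
    (hsing : K 0 = ⊥)
    (hstrict₁ : StrictConcaveOn ℝ (Iio (0 : ℝ)) (fun t => (K t).toReal))
    (hstrict₂ : StrictConcaveOn ℝ (Ioi (0 : ℝ)) (fun t => (K t).toReal))
    (n : ℕ) (hn : 0 < n) (r : Fin n → ℝ) (hr : ∀ j, 0 < r j)
    (hJ : IsFieldFn n J) (hadm : IsAdmissible K J (∑ j, r j)) :
    ¬ ∃ x y : Fin n → ℝ, x ≠ y ∧ Monotone x ∧ Monotone y ∧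
      (∀ j : Fin (n + 1), mloc K J r x j ≠ ⊥ ∧ mloc K J r x j ≠ ⊤) ∧
      (∀ j : Fin (n + 1), mloc K J r y j ≠ ⊥ ∧ mloc K J r y j ≠ ⊤) ∧
      (∀ j : Fin (n + 1), mloc K J r y j ≤ mloc K J r x j) := by
  rintro ⟨x, y, hxy, -, hy, hmx, -, hle⟩
  obtain ⟨c, hc⟩ := hJ.1
  obtain ⟨σ, hσ, hpos, hneg⟩ := exists_signed_supergradient hstrict₁ hstrict₂
    (fun s hs t ht hst => EReal.toReal_le_toReal (hK.2.1 hs ht hst)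
      (hK.1.1 t (ne_of_lt ht)).1 (hK.1.1 s (ne_of_lt hs)).2)
    (fun s hs t ht hst => EReal.toReal_le_toReal (hK.2.2 hs ht hst)
      (hK.1.1 s (ne_of_gt hs)).1 (hK.1.1 t (ne_of_gt ht)).2)
  set ext : (Fin n → ℝ) → ℕ → ℝ := fun w i =>
    if h : 1 ≤ i ∧ i ≤ n then w ⟨i - 1, by omega⟩ else 0 with hext
  have hext_succ : ∀ (w : Fin n → ℝ) (i : Fin n), ext w (i + 1) = w i := fun w i => by
    simp only [hext]
    rw [dif_pos ⟨by omega, i.2⟩]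
    rfl
  have hext_mono : MonotoneOn (ext y) (Icc 1 n) := by
    intro a ha b hb hab
    simp only [hext]
    rw [dif_pos (mem_Icc.1 ha), dif_pos (mem_Icc.1 hb)]
    exact hy (Fin.mk_le_mk.2 (by omega))
  have hext_zero : ∀ w, ext w 0 = 0 := fun w => dif_neg (by omega)
  have hext_last : ∀ w, ext w (n + 1) = 0 := fun w => dif_neg (by omega)
  obtain ⟨j, hjn, hj1, hj2, hsum⟩ := exists_cell_sum_pos hσ hpos hneg hr (x := ext x) hext_mono
    (by rw [hext_zero, hext_zero]) (by rw [hext_last, hext_last])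
    (by simpa only [hext_succ] using Function.ne_iff.1 hxy)
  simp only [hext_succ] at hsum
  set j' : Fin (n + 1) := ⟨j, Nat.lt_succ_of_le hjn⟩ with hj'
  refine (mloc_lt_mloc hK hsing hr hc
    (fun L => eventually_sumTrans_lt_cocompact hK.1 hr hσ hpos hneg hadm L)
    (hmx j').1 (hmx j').2 fun t ht => ?_).not_ge (hle j')
  have hext_t : ∀ i ∈ Icc 1 n, (i ≤ j → ext x i < t) ∧ (j < i → t < ext x i) := by
    intro i hi
    obtain ⟨i, rfl⟩ : ∃ i', i = i' + 1 := ⟨i - 1, by have := hi.1; omega⟩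
    have h := ht ⟨i, hi.2⟩
    rw [← hext_succ x] at h
    exact ⟨fun h' => h.1 h', fun h' => h.2 (Nat.lt_succ_iff.1 h')⟩
  refine ⟨fun i => ?_, hsum t hext_t⟩
  have hi : (i : ℕ) + 1 ∈ Icc 1 n := ⟨by omega, i.2⟩
  rw [← hext_succ y i]
  refine ⟨fun hij => ?_, fun hij => ?_⟩
  · have hj : j ∈ Icc 1 n := ⟨hi.1.trans hij, hjn⟩
    exact (hext_mono hi hj hij).trans_lt (hj1.trans_lt ((hext_t j hj).1 le_rfl))
  · have hj : j + 1 ∈ Icc 1 n := ⟨by omega, (Nat.succ_le_succ hij).trans hi.2⟩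
    exact ((hext_t _ hj).2 (Nat.lt_succ_self j)).trans_le
      (hj2.trans (hext_mono hj hi (Nat.succ_le_succ hij)))
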